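/- For every ε > 0 there exist ρ > 0 and infinitely differentiable (C^∞) functions v, h : ℝ → ℝ such that: v(r) = e^r and h(r) = e^r for all r ≤ −ρ; v(r) = sinh(r) and h(r) = cosh(r) for all r ≥ ε; and the functions v and h, their first derivatives v′ and h′, and their second derivatives v″ and h″ are positive at every point of ℝ. -/

import Mathlib

open Filter Topology Real

/-- `f` is smooth with first derivative `f₁` and second derivative `f₂`. -/
structure HasSmoothDerivs (f f₁ f₂ : ℝ → ℝ) : Prop where
  contDiff : ContDiff ℝ (⊤ : ℕ∞) f
  hasDerivAt : ∀ x, HasDerivAt f (f₁ x) x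
  hasDerivAt₁ : ∀ x, HasDerivAt f₁ (f₂ x) x

namespace HasSmoothDerivs

variable {f f₁ f₂ g g₁ g₂ : ℝ → ℝ}

theorem add (hf : HasSmoothDerivs f f₁ f₂) (hg : HasSmoothDerivs g g₁ g₂) :
    HasSmoothDerivs (fun x => f x + g x) (fun x => f₁ x + g₁ x) (fun x => f₂ x + g₂ x) :=
  ⟨hf.contDiff.add hg.contDiff, fun x => (hf.hasDerivAt x).add (hg.hasDerivAt x),
    fun x => (hf.hasDerivAt₁ x).add (hg.hasDerivAt₁ x)⟩

/-- Rescaling the values by `c` and precomposing with an affine map. -/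
theorem rescale (hf : HasSmoothDerivs f f₁ f₂) (c β γ : ℝ) :
    HasSmoothDerivs (fun x => c * f (β * x + γ)) (fun x => c * β * f₁ (β * x + γ))
      (fun x => c * β ^ 2 * f₂ (β * x + γ)) := by
  have haff : ∀ x, HasDerivAt (fun x : ℝ => β * x + γ) β x := fun x => by
    simpa using ((hasDerivAt_id x).const_mul β).add_const γ
  refine ⟨contDiff_const.mul (hf.contDiff.comp (by fun_prop)), fun x => ?_, fun x => ?_⟩
  · exact (((hf.hasDerivAt (β * x + γ)).comp x (haff x)).const_mul c).congr_deriv (by ring)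
  · exact (((hf.hasDerivAt₁ (β * x + γ)).comp x (haff x)).const_mul (c * β)).congr_deriv (by ring)

/-- Two functions with the same second derivative on a convex set and the same value and slope
at one of its points agree there. -/
theorem eq_of_eqOn (hf : HasSmoothDerivs f f₁ f₂) (hg : HasSmoothDerivs g g₁ g₂) {s : Set ℝ}
    (hs : Convex ℝ s) {a : ℝ} (ha : a ∈ s) (h₂ : ∀ x ∈ s, f₂ x = g₂ x) (h₁ : f₁ a = g₁ a)
    (h : f a = g a) {x : ℝ} (hx : x ∈ s) : f x = g x ∧ f₁ x = g₁ x := by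
  have key : ∀ {F F' : ℝ → ℝ}, (∀ x, HasDerivAt F (F' x) x) → (∀ x ∈ s, F' x = 0) → F a = 0 →
      ∀ x ∈ s, F x = 0 := by
    intro F F' hF h0 hFa x hx
    have := hs.norm_image_sub_le_of_norm_hasDerivWithin_le (C := 0)
      (fun y _ => (hF y).hasDerivWithinAt) (fun y hy => by simp [h0 y hy]) ha hx
    simpa [hFa] using this
  have e₁ : ∀ x ∈ s, f₁ x - g₁ x = 0 :=
    key (fun x => (hf.hasDerivAt₁ x).sub (hg.hasDerivAt₁ x))
      (fun x hx => sub_eq_zero.2 (h₂ x hx)) (sub_eq_zero.2 h₁)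
  have e : ∀ x ∈ s, f x - g x = 0 :=
    key (fun x => (hf.hasDerivAt x).sub (hg.hasDerivAt x)) e₁ (sub_eq_zero.2 h)
  exact ⟨sub_eq_zero.1 (e x hx), sub_eq_zero.1 (e₁ x hx)⟩

/-- A function with positive second derivative on `(a, b)` and nonnegative value and slope at `a`
has positive value and slope at `b`. -/
theorem pos_of_pos (hf : HasSmoothDerivs f f₁ f₂) {a b : ℝ} (hab : a < b)
    (h₂ : ∀ x, a < x → x < b → 0 < f₂ x) (h₁ : 0 ≤ f₁ a) (h : 0 ≤ f a) : 0 < f b ∧ 0 < f₁ b := by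
  have key : ∀ {F F' : ℝ → ℝ}, (∀ x, HasDerivAt F (F' x) x) → (∀ x, a < x → x < b → 0 < F' x) →
      StrictMonoOn F (Set.Icc a b) := by
    intro F F' hF hpos
    refine strictMonoOn_of_hasDerivWithinAt_pos (f' := F') (convex_Icc a b)
      (fun x _ => (hF x).continuousAt.continuousWithinAt)
      (fun x _ => (hF x).hasDerivWithinAt) fun x hx => ?_
    rw [interior_Icc] at hx
    exact hpos x hx.1 hx.2
  have m₁ := key hf.hasDerivAt₁ h₂
  have m := key hf.hasDerivAt fun x hax hxb =>
    h₁.trans_lt (m₁ (Set.left_mem_Icc.2 hab.le) ⟨hax.le, hxb.le⟩ hax)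
  exact ⟨h.trans_lt (m (Set.left_mem_Icc.2 hab.le) (Set.right_mem_Icc.2 hab.le) hab),
    h₁.trans_lt (m₁ (Set.left_mem_Icc.2 hab.le) (Set.right_mem_Icc.2 hab.le) hab)⟩

protected theorem exp : HasSmoothDerivs exp exp exp :=
  ⟨contDiff_exp, hasDerivAt_exp, hasDerivAt_exp⟩

protected theorem sinh : HasSmoothDerivs sinh cosh sinh :=
  ⟨contDiff_sinh, hasDerivAt_sinh, hasDerivAt_cosh⟩

protected theorem cosh : HasSmoothDerivs cosh sinh cosh :=
  ⟨contDiff_cosh, hasDerivAt_cosh, hasDerivAt_sinh⟩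

protected theorem affine (a b c : ℝ) :
    HasSmoothDerivs (fun x => b + a * (x - c)) (fun _ => a) (fun _ => 0) :=
  ⟨by fun_prop, fun x => by
    simpa using (((hasDerivAt_id x).sub_const c).const_mul a).const_add b,
    fun x => hasDerivAt_const x a⟩

theorem deriv_eq (hf : HasSmoothDerivs f f₁ f₂) : deriv f = f₁ :=
  funext fun x => (hf.hasDerivAt x).deriv

theorem deriv_deriv_eq (hf : HasSmoothDerivs f f₁ f₂) : deriv (deriv f) = f₂ := by
  rw [hf.deriv_eq]
  exact funext fun x => (hf.hasDerivAt₁ x).deriv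

theorem contDiff₂ (hf : HasSmoothDerivs f f₁ f₂) : ContDiff ℝ (⊤ : ℕ∞) f₂ := by
  rw [← hf.deriv_deriv_eq]
  exact (contDiff_infty_iff_deriv.1 (contDiff_infty_iff_deriv.1 hf.contDiff).2).2

end HasSmoothDerivs

theorem exists_hasSmoothDerivs {u : ℝ → ℝ} (hu : ContDiff ℝ (⊤ : ℕ∞) u) (a y y₁ : ℝ) :
    ∃ f f₁, HasSmoothDerivs f f₁ u ∧ f a = y ∧ f₁ a = y₁ := by
  have key : ∀ {w : ℝ → ℝ}, ContDiff ℝ (⊤ : ℕ∞) w → ∀ z : ℝ,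
      ∃ F, ContDiff ℝ (⊤ : ℕ∞) F ∧ (∀ x, HasDerivAt F (w x) x) ∧ F a = z := by
    intro w hw z
    have hd : ∀ x, HasDerivAt (fun x => z + ∫ t in a..x, w t) (w x) x := fun x =>
      (hw.continuous.integral_hasStrictDerivAt a x).hasDerivAt.const_add z
    refine ⟨_, contDiff_infty_iff_deriv.2 ⟨fun x => (hd x).differentiableAt, ?_⟩, hd, by simp⟩
    rwa [show deriv (fun x => z + ∫ t in a..x, w t) = w from funext fun x => (hd x).deriv]
  obtain ⟨f₁, hc₁, hd₁, hy₁⟩ := key hu y₁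
  obtain ⟨f, hc, hd, hy⟩ := key hc₁ y
  exact ⟨f, f₁, ⟨hc, hd, hd₁⟩, hy, hy₁⟩

/-- A smooth convex function vanishing on `(-∞, -1]` and affine with positive value and slope at
`0` on `[0, ∞)`. -/
theorem exists_smooth_hinge : ∃ k k₁ k₂ : ℝ → ℝ, HasSmoothDerivs k k₁ k₂ ∧ 0 < k 0 ∧ 0 < k₁ 0 ∧
    (∀ x ≤ -1, k x = 0) ∧ (∀ x, 0 ≤ k₂ x) ∧ (∀ x, -1 < x → x < 0 → 0 < k₂ x) ∧
    ∀ x, 0 ≤ x → k₂ x = 0 := by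
  have hu : ContDiff ℝ (⊤ : ℕ∞) fun x : ℝ => expNegInvGlue (x + 1) * expNegInvGlue (-x) :=
    (expNegInvGlue.contDiff.comp (by fun_prop)).mul (expNegInvGlue.contDiff.comp (by fun_prop))
  obtain ⟨k, k₁, hk, h0, h1⟩ := exists_hasSmoothDerivs hu (-1) 0 0
  have hpos : ∀ x : ℝ, -1 < x → x < 0 → 0 < expNegInvGlue (x + 1) * expNegInvGlue (-x) :=
    fun x hx hx' => mul_pos (expNegInvGlue.pos_of_pos (by linarith))
      (expNegInvGlue.pos_of_pos (by linarith))
  obtain ⟨p, p₁⟩ := hk.pos_of_pos (by norm_num) hpos h1.ge h0.ge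
  refine ⟨k, k₁, _, hk, p, p₁, fun x hx => ?_,
    fun x => mul_nonneg (expNegInvGlue.nonneg _) (expNegInvGlue.nonneg _), hpos, fun x hx => ?_⟩
  · refine (hk.eq_of_eqOn (HasSmoothDerivs.affine 0 0 0) (convex_Iic (-1)) Set.self_mem_Iic
      (fun y hy => ?_) h1 (by simpa using h0) hx).1.trans (by simp)
    rw [expNegInvGlue.zero_of_nonpos (by linarith [Set.mem_Iic.1 hy]), zero_mul]
  · rw [expNegInvGlue.zero_of_nonpos (x := -x) (by linarith), mul_zero]

/-- A smooth convex function equal to `exp` on `(-∞, 0]` and affine on `[1, ∞)`. -/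
theorem exists_exp_to_affine : ∃ q q₁ q₂ : ℝ → ℝ, HasSmoothDerivs q q₁ q₂ ∧
    (∀ x ≤ 0, q x = exp x) ∧ (∀ x, 0 ≤ q₂ x) ∧ (∀ x < 1, 0 < q₂ x) ∧ (∀ x, 1 ≤ x → q₂ x = 0) ∧
    ∃ a b : ℝ, ∀ x, 1 ≤ x → q x = b + a * (x - 1) ∧ q₁ x = a := by
  have hu : ContDiff ℝ (⊤ : ℕ∞) fun x : ℝ => exp x * (1 - smoothTransition x) :=
    contDiff_exp.mul (contDiff_const.sub smoothTransition.contDiff)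
  obtain ⟨q, q₁, hq, h0, h1⟩ := exists_hasSmoothDerivs hu 0 1 1
  have hz : ∀ x : ℝ, 1 ≤ x → exp x * (1 - smoothTransition x) = 0 := fun x hx => by
    simp [smoothTransition.one_of_one_le hx]
  refine ⟨q, q₁, _, hq, fun x hx => ?_, fun x => ?_, fun x hx => ?_, hz, q₁ 1, q 1,
    fun x hx => ?_⟩
  · refine (hq.eq_of_eqOn HasSmoothDerivs.exp (convex_Iic 0) Set.self_mem_Iic
      (fun y hy => ?_) (by simpa using h1) (by simpa using h0) hx).1
    rw [smoothTransition.zero_of_nonpos hy, sub_zero, mul_one]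
  · exact mul_nonneg (exp_pos x).le (sub_nonneg.2 (smoothTransition.le_one x))
  · exact mul_pos (exp_pos x) (sub_pos.2 (smoothTransition.lt_one_of_lt_one hx))
  · exact hq.eq_of_eqOn (HasSmoothDerivs.affine (q₁ 1) (q 1) 1) (convex_Ici 1) Set.self_mem_Ici
      hz rfl (by simp) hx

/-- A function with nonnegative value and slope at `0` that is strictly convex on `(0, ∞)` can be
truncated to a smooth convex function vanishing on `(-∞, 0]`, with the same second derivative on
`[ε, ∞)` and smaller value and slope at `ε`. -/
theorem exists_truncation {g g₁ g₂ : ℝ → ℝ} (hg : HasSmoothDerivs g g₁ g₂) (h0 : 0 ≤ g 0)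
    (h1 : 0 ≤ g₁ 0) (h2 : ∀ x, 0 < x → 0 < g₂ x) {ε : ℝ} (hε : 0 < ε) :
    ∃ p p₁ p₂ : ℝ → ℝ, HasSmoothDerivs p p₁ p₂ ∧ (∀ x ≤ 0, p x = 0) ∧ (∀ x, 0 ≤ p₂ x) ∧
      (∀ x, ε ≤ x → p₂ x = g₂ x) ∧ p ε < g ε ∧ p₁ ε < g₁ ε := by
  have hu : ContDiff ℝ (⊤ : ℕ∞) fun x : ℝ => smoothTransition (x / ε) * g₂ x :=
    (smoothTransition.contDiff.comp (contDiff_id.div_const ε)).mul hg.contDiff₂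
  obtain ⟨p, p₁, hp, hp0, hp1⟩ := exists_hasSmoothDerivs hu 0 0 0
  have hz : ∀ x : ℝ, x ≤ 0 → smoothTransition (x / ε) * g₂ x = 0 := fun x hx => by
    rw [smoothTransition.zero_of_nonpos (div_nonpos_of_nonpos_of_nonneg hx hε.le), zero_mul]
  have hd := (hg.add (hp.rescale (-1) 1 0)).pos_of_pos hε (fun x hx hx' => by
    have ht := smoothTransition.lt_one_of_lt_one ((div_lt_one hε).2 hx')
    have := mul_pos (sub_pos.2 ht) (h2 x hx)
    simp only [one_mul, add_zero]
    linarith) (by simpa [hp1] using h1) (by simpa [hp0] using h0)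
  simp only [one_mul, add_zero, mul_one, neg_one_mul] at hd
  refine ⟨p, p₁, _, hp, fun x hx => ?_, fun x => ?_, fun x hx => ?_, by linarith [hd.1],
    by linarith [hd.2]⟩
  · exact (hp.eq_of_eqOn (HasSmoothDerivs.affine 0 0 0) (convex_Iic 0) Set.self_mem_Iic
      hz hp1 (by simpa using hp0) hx).1.trans (by simp)
  · rcases le_or_gt x 0 with hx | hx
    · exact (hz x hx).ge
    · exact mul_nonneg (smoothTransition.nonneg _) (h2 x hx).le
  · rw [smoothTransition.one_of_one_le ((one_le_div hε).2 hx), one_mul]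

/-- Smooth interpolation, with positive value and first two derivatives, between `exp` near `-∞`
and a function `g` which has nonnegative value and slope at `0` and is strictly convex on
`(0, ∞)`. -/
theorem exists_convex_interpolation {g g₁ g₂ : ℝ → ℝ} (hg : HasSmoothDerivs g g₁ g₂)
    (h0 : 0 ≤ g 0) (h1 : 0 ≤ g₁ 0) (h2 : ∀ x, 0 < x → 0 < g₂ x) {ε : ℝ} (hε : 0 < ε) :
    ∃ ρ : ℝ, 0 < ρ ∧ ∃ f : ℝ → ℝ, ContDiff ℝ (⊤ : ℕ∞) f ∧ (∀ r ≤ -ρ, f r = exp r) ∧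
      (∀ r, ε ≤ r → f r = g r) ∧ ∀ r, 0 < f r ∧ 0 < deriv f r ∧ 0 < deriv (deriv f) r := by
  obtain ⟨k, k₁, k₂, hk, hk0, hk10, hkz, hk2n, hk2p, hk2z⟩ := exists_smooth_hinge
  obtain ⟨q, q₁, q₂, hq, hqe, hq2n, hq2p, hq2z, a, b, hqab⟩ := exists_exp_to_affine
  obtain ⟨p, p₁, p₂, hp, hpz, hp2n, hp2g, hpε, hp1ε⟩ := exists_truncation hg h0 h1 h2 hε
  -- Far enough to the left, the affine continuation of `exp` is small at `ε`.
  obtain ⟨n, hn1, hn, hn'⟩ : ∃ n : ℝ, 1 ≤ n ∧ exp (-n) * q (1 * ε + n) < g ε - p ε ∧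
      exp (-n) * 1 * q₁ (1 * ε + n) < g₁ ε - p₁ ε := by
    have t0 : Tendsto (fun n : ℝ => exp (-n)) atTop (𝓝 0) := tendsto_exp_neg_atTop_nhds_zero
    have t1 : Tendsto (fun n : ℝ => n * exp (-n)) atTop (𝓝 0) := by
      simpa using tendsto_pow_mul_exp_neg_atTop_nhds_zero 1
    have t2 : Tendsto (fun n : ℝ => exp (-n) * (b + a * (ε - 1)) + a * (n * exp (-n))) atTop
        (𝓝 0) := by simpa using (t0.mul_const _).add (t1.const_mul a)
    have t3 : Tendsto (fun n : ℝ => exp (-n) * a) atTop (𝓝 0) := by simpa using t0.mul_const a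
    obtain ⟨n, hn, h, h'⟩ := ((eventually_ge_atTop 1).and
      ((t2.eventually_lt_const (sub_pos.2 hpε)).and
        (t3.eventually_lt_const (sub_pos.2 hp1ε)))).exists
    obtain ⟨e, e₁⟩ := hqab (1 * ε + n) (by linarith)
    refine ⟨n, hn, ?_, ?_⟩
    · rw [e]
      linarith
    · rwa [e₁, mul_one]
  have hP := (hq.rescale (exp (-n)) 1 n).add hp
  have hnε : 0 < n + ε := by linarith
  -- A small hinge spanning `[-n, ε]` makes the second derivative positive there.
  obtain ⟨κ, hκ, hκB, hκA⟩ : ∃ κ : ℝ, 0 < κ ∧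
      κ * k 0 < g ε - p ε - exp (-n) * q (1 * ε + n) ∧
      κ * (n + ε)⁻¹ * k₁ 0 < g₁ ε - p₁ ε - exp (-n) * 1 * q₁ (1 * ε + n) := by
    have t1 : Tendsto (fun κ : ℝ => κ * k 0) (𝓝[>] 0) (𝓝 0) := by
      refine Tendsto.mono_left ?_ nhdsWithin_le_nhds
      exact Continuous.tendsto' (by fun_prop) _ _ (by simp)
    have t2 : Tendsto (fun κ : ℝ => κ * (n + ε)⁻¹ * k₁ 0) (𝓝[>] 0) (𝓝 0) := by
      refine Tendsto.mono_left ?_ nhdsWithin_le_nhds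
      exact Continuous.tendsto' (by fun_prop) _ _ (by simp)
    exact (eventually_mem_nhdsWithin.and ((t1.eventually_lt_const (sub_pos.2 hn)).and
      (t2.eventually_lt_const (sub_pos.2 hn')))).exists
  set d := g ε - p ε - exp (-n) * q (1 * ε + n) - κ * k 0 with hd
  set d₁ := g₁ ε - p₁ ε - exp (-n) * 1 * q₁ (1 * ε + n) - κ * (n + ε)⁻¹ * k₁ 0 with hd₁
  have hdpos : 0 < d := sub_pos.2 hκB
  have hd₁pos : 0 < d₁ := sub_pos.2 hκA
  -- A second hinge corrects the value and the slope at `ε`.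
  obtain ⟨β, hβ, hβd⟩ : ∃ β : ℝ, 0 < β ∧ d / k 0 * β * k₁ 0 = d₁ :=
    ⟨d₁ * k 0 / (d * k₁ 0), by positivity, by field_simp⟩
  have hα : d / k 0 * k 0 = d := by field_simp
  have hα0 : 0 < d / k 0 := by positivity
  have hf := (hP.add (hk.rescale κ (n + ε)⁻¹ (-((n + ε)⁻¹ * ε)))).add
    (hk.rescale (d / k 0) β (-(β * ε)))
  generalize d / k 0 = α at *
  have hleft : ∀ r ≤ -(n + 1 / β), exp (-n) * q (1 * r + n) + p r +
      κ * k ((n + ε)⁻¹ * r + -((n + ε)⁻¹ * ε)) + α * k (β * r + -(β * ε)) = exp r := by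
    intro r hr
    have hβ' : 0 < 1 / β := by positivity
    have e1 : (n + ε)⁻¹ * r + -((n + ε)⁻¹ * ε) ≤ -1 := by
      have : (n + ε)⁻¹ * r + -((n + ε)⁻¹ * ε) = -((ε - r) / (n + ε)) := by ring
      rw [this, neg_le_neg_iff, one_le_div hnε]
      linarith
    have e2 : β * r + -(β * ε) ≤ -1 := by
      have h3 : β * r ≤ β * -(1 / β) := mul_le_mul_of_nonneg_left (by linarith) hβ.le
      have h4 : β * -(1 / β) = -1 := by field_simp
      nlinarith
    rw [hkz _ e1, hkz _ e2, hpz r (by linarith), hqe _ (by linarith), ← exp_add]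
    ring_nf
  have hright : ∀ r, ε ≤ r → ∀ c, 0 < c → k₂ (c * r + -(c * ε)) = 0 := fun r hr c hc =>
    hk2z _ (by nlinarith)
  have hpos₂ : ∀ r, 0 < exp (-n) * 1 ^ 2 * q₂ (1 * r + n) + p₂ r +
      κ * (n + ε)⁻¹ ^ 2 * k₂ ((n + ε)⁻¹ * r + -((n + ε)⁻¹ * ε)) +
      α * β ^ 2 * k₂ (β * r + -(β * ε)) := by
    intro r
    have s1 : 0 ≤ exp (-n) * 1 ^ 2 * q₂ (1 * r + n) := mul_nonneg (by positivity) (hq2n _)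
    have s2 := hp2n r
    have s3 : 0 ≤ κ * (n + ε)⁻¹ ^ 2 * k₂ ((n + ε)⁻¹ * r + -((n + ε)⁻¹ * ε)) :=
      mul_nonneg (by positivity) (hk2n _)
    have s4 : 0 ≤ α * β ^ 2 * k₂ (β * r + -(β * ε)) := mul_nonneg (by positivity) (hk2n _)
    rcases le_or_gt r (-n) with hr | hr
    · have : 0 < exp (-n) * 1 ^ 2 * q₂ (1 * r + n) :=
        mul_pos (by positivity) (hq2p _ (by linarith))
      linarith
    rcases lt_or_ge r ε with hr' | hr'
    · have : 0 < κ * (n + ε)⁻¹ ^ 2 * k₂ ((n + ε)⁻¹ * r + -((n + ε)⁻¹ * ε)) := by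
        have e : (n + ε)⁻¹ * r + -((n + ε)⁻¹ * ε) = -((ε - r) / (n + ε)) := by ring
        refine mul_pos (by positivity) (hk2p _ ?_ ?_)
        · rw [e, neg_lt_neg_iff, div_lt_one hnε]
          linarith
        · rw [e, neg_lt_zero]
          exact div_pos (by linarith) hnε
      linarith
    · have := h2 r (hε.trans_le hr')
      rw [← hp2g r hr'] at this
      linarith
  have hρ : 0 < n + 1 / β := by positivity
  refine ⟨n + 1 / β, hρ, _, hf.contDiff, hleft, fun r hr => ?_, fun r => ?_⟩
  · refine (hf.eq_of_eqOn hg (convex_Ici ε) Set.self_mem_Ici (fun x hx => ?_) ?_ ?_ hr).1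
    · have hx : ε ≤ x := hx
      rw [hright x hx _ (inv_pos.2 hnε), hright x hx _ hβ, hq2z _ (by linarith), hp2g x hx]
      ring
    · simp only [add_neg_cancel]
      linarith
    · simp only [add_neg_cancel]
      linarith
  · rw [hf.deriv_deriv_eq]
    set L := min (r - 1) (-(n + 1 / β) - 1) with hL
    have hLr : L < r := (min_le_left _ _).trans_lt (by linarith)
    have hLρ : L < -(n + 1 / β) := (min_le_right _ _).trans_lt (by linarith)
    have hd1 := ((hf.hasDerivAt L).congr_of_eventuallyEq (f₁ := exp) (by
      filter_upwards [Iio_mem_nhds hLρ] with x hx using (hleft x (le_of_lt hx)).symm)).unique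
        (hasDerivAt_exp L)
    obtain ⟨hfr, hf₁r⟩ := hf.pos_of_pos hLr (fun x _ _ => hpos₂ x)
      (hd1.symm ▸ (exp_pos L).le) ((hleft L hLρ.le).symm ▸ (exp_pos L).le)
    exact ⟨hfr, by rwa [hf.deriv_eq], hpos₂ r⟩

/-- Construction of the warping functions: smooth `v`, `h` equal to `e^r` for
`r ≤ -ρ`, equal to `sinh`, `cosh` for `r ≥ ε`, with `v, h, v', h', v'', h''`
everywhere positive. -/
theorem exists_warping_functions (ε : ℝ) (hε : 0 < ε) :
    ∃ ρ : ℝ, 0 < ρ ∧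
      ∃ v h : ℝ → ℝ,
        ContDiff ℝ (⊤ : ℕ∞) v ∧ ContDiff ℝ (⊤ : ℕ∞) h ∧
        (∀ r ≤ -ρ, v r = Real.exp r ∧ h r = Real.exp r) ∧
        (∀ r, ε ≤ r → v r = Real.sinh r ∧ h r = Real.cosh r) ∧
        (∀ r : ℝ,
          0 < v r ∧ 0 < h r ∧
          0 < deriv v r ∧ 0 < deriv h r ∧
          0 < deriv (deriv v) r ∧ 0 < deriv (deriv h) r) := by
  obtain ⟨ρ₁, hρ₁, v, hv, hvl, hvr, hvp⟩ := exists_convex_interpolation HasSmoothDerivs.sinh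
    (by simp) (by simp) (fun x hx => sinh_pos_iff.2 hx) hε
  obtain ⟨ρ₂, -, h, hh, hhl, hhr, hhp⟩ := exists_convex_interpolation HasSmoothDerivs.cosh
    (by simp) (by simp) (fun x _ => cosh_pos x) hε
  refine ⟨max ρ₁ ρ₂, lt_max_of_lt_left hρ₁, v, h, hv, hh, fun r hr => ?_,
    fun r hr => ⟨hvr r hr, hhr r hr⟩, fun r => ?_⟩
  · exact ⟨hvl r (by linarith [le_max_left ρ₁ ρ₂]), hhl r (by linarith [le_max_right ρ₁ ρ₂])⟩
  · exact ⟨(hvp r).1, (hhp r).1, (hvp r).2.1, (hhp r).2.1, (hvp r).2.2, (hhp r).2.2⟩
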